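/- Let γ_u > 0 for all u ⊆ {1,…,d} with γ_{{1}} π^{-2} ≥ γ_u π^{-2|u|} for all nonempty u. Then the smallest ρ > 0 such that the ball B(γ,ρ) = { f : ‖f‖_γ ≤ ρ } contains a function with variance σ²(f) = 1 is ρ* = π / √(γ_{{1}}). -/

import Mathlib

open MeasureTheory Real Finset

noncomputable section

/-- The unit cube `[0,1]^d`. -/
def cube (d : ℕ) : Set (Fin d → ℝ) := Set.univ.pi fun _ => Set.Icc (0:ℝ) 1

/-- Partial derivative of `g` with respect to coordinate `j`. -/
def pderiv {d : ℕ} (j : Fin d) (g : (Fin d → ℝ) → ℝ) : (Fin d → ℝ) → ℝ :=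
  fun x => deriv (fun t => g (Function.update x j t)) (x j)

/-- Mixed partial derivative `∂^u g`, one derivative for each coordinate in `u`. -/
def mderiv {d : ℕ} (u : Finset (Fin d)) (g : (Fin d → ℝ) → ℝ) : (Fin d → ℝ) → ℝ :=
  u.toList.foldr pderiv g

/-- `margOut u g x = ∫ g dx_{-u}` : integral over the coordinates outside `u`. -/
def margOut {d : ℕ} (u : Finset (Fin d)) (g : (Fin d → ℝ) → ℝ) : (Fin d → ℝ) → ℝ :=
  fun x => ∫ z in cube d, g (fun j => if j ∈ u then x j else z j)

/-- All mixed partial derivatives of `f` exist and are continuous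
(the paper's condition that `∂^{1:d} f` is continuous). -/
def SmoothEnough {d : ℕ} (f : (Fin d → ℝ) → ℝ) : Prop :=
  (∀ (v : Finset (Fin d)) (j : Fin d) (x : Fin d → ℝ),
      DifferentiableAt ℝ (fun t => mderiv v f (Function.update x j t)) (x j)) ∧
  ∀ v : Finset (Fin d), Continuous (mderiv v f)

/-- Squared unanchored weighted Sobolev norm `‖f‖_γ²`. -/
def wnorm2 {d : ℕ} (γ : Finset (Fin d) → ℝ) (f : (Fin d → ℝ) → ℝ) : ℝ :=
  ∑ u : Finset (Fin d), (γ u)⁻¹ * ∫ x in cube d, (margOut u (mderiv u f) x) ^ 2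

/-- `F` is the ANOVA decomposition of `f`: `f = ∑_u F u`, each `F u` depends only on
the coordinates in `u`, and `∫_0^1 F u dx_j = 0` for every `j ∈ u`. -/
def IsANOVA {d : ℕ} (f : (Fin d → ℝ) → ℝ)
    (F : Finset (Fin d) → (Fin d → ℝ) → ℝ) : Prop :=
  (∀ x, f x = ∑ u : Finset (Fin d), F u x) ∧
  (∀ u : Finset (Fin d), ∀ x y : Fin d → ℝ, (∀ j ∈ u, x j = y j) → F u x = F u y) ∧
  (∀ u : Finset (Fin d), ∀ j ∈ u, ∀ x : Fin d → ℝ,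
      ∫ t in (0:ℝ)..1, F u (Function.update x j t) = 0)

/-- ANOVA variance component `σ_u² = ∫ f_u²`. -/
def sigma2 {d : ℕ} (F : Finset (Fin d) → (Fin d → ℝ) → ℝ) (u : Finset (Fin d)) : ℝ :=
  ∫ x in cube d, (F u x) ^ 2

/-- Mean `μ = ∫ f`. -/
def fmean {d : ℕ} (f : (Fin d → ℝ) → ℝ) : ℝ := ∫ x in cube d, f x

/-- Variance `σ²(f) = ∫ (f - μ)²`. -/
def fvar {d : ℕ} (f : (Fin d → ℝ) → ℝ) : ℝ := ∫ x in cube d, (f x - fmean f) ^ 2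

/-- The critical radius `ρ*(γ)`: the smallest radius of a `γ`-ball containing a
function of unit variance. -/
def rhoStar {d : ℕ} (γ : Finset (Fin d) → ℝ) : ℝ :=
  sInf {ρ : ℝ | 0 < ρ ∧ ∃ f : (Fin d → ℝ) → ℝ,
    SmoothEnough f ∧ wnorm2 γ f ≤ ρ ^ 2 ∧ fvar f = 1}

theorem dirichlet_c (H w : ℝ → ℝ) (hH : ∀ x, HasDerivAt H (w x) x) (hw : Continuous w)
    (h0 : H 0 = 0) (h1 : H 1 = 0) (c : ℝ) (hc0 : 0 < c) (hc : c < π) :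
    c ^ 2 * ∫ x in (0:ℝ)..1, H x ^ 2 ≤ ∫ x in (0:ℝ)..1, w x ^ 2 := by
  have hHc : Continuous H := continuous_iff_continuousAt.2 fun x => (hH x).continuousAt
  have hcos : ∀ x ∈ Set.uIcc (0:ℝ) 1, cos (c * (x - 1/2)) ≠ 0 := by
    intro x hx
    rw [Set.uIcc_of_le zero_le_one] at hx
    apply ne_of_gt
    apply cos_pos_of_mem_Ioo
    constructor <;> nlinarith [hx.1, hx.2]
  set T : ℝ → ℝ := fun x => sin (c * (x - 1/2)) / cos (c * (x - 1/2)) with hT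
  have hTc : ContinuousOn T (Set.uIcc (0:ℝ) 1) :=
    ContinuousOn.div (by fun_prop) (by fun_prop) hcos
  have hTd : ∀ x ∈ Set.uIcc (0:ℝ) 1, HasDerivAt T (c * (1 + T x ^ 2)) x := by
    intro x hx
    have hi : HasDerivAt (fun x : ℝ => c * (x - 1/2)) c x := by
      have := ((hasDerivAt_id x).sub_const (1/2)).const_mul c
      rw [mul_one] at this
      exact this
    have := (hi.sin).div (hi.cos) (hcos x hx)
    convert! this using 1
    have h := hcos x hx
    simp only [hT]
    set S := sin (c * (x - 1/2))
    set C := cos (c * (x - 1/2))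
    field_simp
    ring
  have key : ∫ x in (0:ℝ)..1, (c * (c * (1 + T x ^ 2)) * H x ^ 2 + c * T x * (2 * H x * w x)) = 0 := by
    rw [intervalIntegral.integral_eq_sub_of_hasDerivAt (f := fun x => c * T x * H x ^ 2)]
    · simp [h0, h1]
    · intro x hx
      have := ((hTd x hx).const_mul c).mul ((hH x).pow 2)
      convert! this using 1
      simp
    · apply ContinuousOn.intervalIntegrable
      fun_prop
  have hpos : 0 ≤ ∫ x in (0:ℝ)..1, (w x + c * T x * H x) ^ 2 :=
    intervalIntegral.integral_nonneg zero_le_one fun x _ => sq_nonneg _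
  have i1 : IntervalIntegrable (fun x => w x ^ 2) volume 0 1 := (by fun_prop : Continuous fun x => w x ^ 2).intervalIntegrable _ _
  have i2 : IntervalIntegrable (fun x => c ^ 2 * H x ^ 2) volume 0 1 := (by fun_prop : Continuous fun x => c ^ 2 * H x ^ 2).intervalIntegrable _ _
  have i3 : IntervalIntegrable (fun x => (c * (c * (1 + T x ^ 2)) * H x ^ 2 + c * T x * (2 * H x * w x))) volume 0 1 := by
    apply ContinuousOn.intervalIntegrable
    fun_prop
  have e : ∫ x in (0:ℝ)..1, (w x + c * T x * H x) ^ 2 = (∫ x in (0:ℝ)..1, w x ^ 2) - (∫ x in (0:ℝ)..1, c ^ 2 * H x ^ 2) + ∫ x in (0:ℝ)..1, (c * (c * (1 + T x ^ 2)) * H x ^ 2 + c * T x * (2 * H x * w x)) := by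
    rw [← intervalIntegral.integral_sub i1 i2, ← intervalIntegral.integral_add (i1.sub i2) i3]
    congr 1
    ext x
    ring
  rw [e, key, intervalIntegral.integral_const_mul] at hpos
  linarith

theorem dirichlet (H w : ℝ → ℝ) (hH : ∀ x, HasDerivAt H (w x) x) (hw : Continuous w)
    (h0 : H 0 = 0) (h1 : H 1 = 0) :
    π ^ 2 * ∫ x in (0:ℝ)..1, H x ^ 2 ≤ ∫ x in (0:ℝ)..1, w x ^ 2 := by
  have ht : Filter.Tendsto (fun c : ℝ => c ^ 2 * ∫ x in (0:ℝ)..1, H x ^ 2) (nhdsWithin π (Set.Iio π))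
      (nhds (π ^ 2 * ∫ x in (0:ℝ)..1, H x ^ 2)) :=
    ((by fun_prop : Continuous fun c : ℝ => c ^ 2 * ∫ x in (0:ℝ)..1, H x ^ 2).tendsto π).mono_left
      nhdsWithin_le_nhds
  refine le_of_tendsto ht ?_
  filter_upwards [Ioo_mem_nhdsLT pi_pos] with c hc
  exact dirichlet_c H w hH hw h0 h1 c hc.1 hc.2

theorem poincare1 (h k : ℝ → ℝ) (hh : ∀ x, HasDerivAt h (k x) x) (hk : Continuous k) :
    ∫ x in (0:ℝ)..1, h x ^ 2 ≤ (∫ x in (0:ℝ)..1, h x) ^ 2 + (π ^ 2)⁻¹ * ∫ x in (0:ℝ)..1, k x ^ 2 := by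
  have hhc : Continuous h := continuous_iff_continuousAt.2 fun x => (hh x).continuousAt
  set m := ∫ x in (0:ℝ)..1, h x with hm
  set w : ℝ → ℝ := fun x => h x - m with hw
  have hwc : Continuous w := by fun_prop
  set H : ℝ → ℝ := fun x => ∫ t in (0:ℝ)..x, w t with hHdef
  have hH : ∀ x, HasDerivAt H (w x) x := fun x => (hwc.integral_hasStrictDerivAt 0 x).hasDerivAt
  have hHc : Continuous H := continuous_iff_continuousAt.2 fun x => (hH x).continuousAt
  have H0 : H 0 = 0 := by simp [hHdef]
  have ih : IntervalIntegrable h volume 0 1 := hhc.intervalIntegrable _ _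
  have H1 : H 1 = 0 := by
    simp only [hHdef, hw]
    rw [intervalIntegral.integral_sub ih (by simp)]
    simp [hm]
  have D := dirichlet H w hH hwc H0 H1
  have ib : ∫ x in (0:ℝ)..1, (w x * w x + H x * k x) = 0 := by
    rw [intervalIntegral.integral_eq_sub_of_hasDerivAt (f := fun x => H x * w x)]
    · simp [H0, H1]
    · intro x _
      exact (hH x).mul ((hh x).sub_const m)
    · exact (by fun_prop : Continuous fun x => (w x * w x + H x * k x)).intervalIntegrable _ _
  have hpos : 0 ≤ ∫ x in (0:ℝ)..1, (k x + π ^ 2 * H x) ^ 2 :=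
    intervalIntegral.integral_nonneg zero_le_one fun x _ => sq_nonneg _
  have I : ∀ g : ℝ → ℝ, Continuous g → IntervalIntegrable g volume 0 1 := fun g hg => hg.intervalIntegrable _ _
  have e : ∫ x in (0:ℝ)..1, (k x + π ^ 2 * H x) ^ 2 = (∫ x in (0:ℝ)..1, k x ^ 2) + 2 * π ^ 2 * (∫ x in (0:ℝ)..1, (w x * w x + H x * k x)) - 2 * π ^ 2 * (∫ x in (0:ℝ)..1, w x ^ 2) + π ^ 4 * (∫ x in (0:ℝ)..1, H x ^ 2) := by
    simp only [← intervalIntegral.integral_const_mul]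
    rw [← intervalIntegral.integral_add (I _ (by fun_prop)) (I _ (by fun_prop)),
      ← intervalIntegral.integral_sub (I _ (by fun_prop)) (I _ (by fun_prop)),
      ← intervalIntegral.integral_add (I _ (by fun_prop)) (I _ (by fun_prop))]
    congr 1
    ext x
    ring
  have e2 : ∫ x in (0:ℝ)..1, w x ^ 2 = (∫ x in (0:ℝ)..1, h x ^ 2) - m ^ 2 := by
    have : ∫ x in (0:ℝ)..1, w x ^ 2 = (∫ x in (0:ℝ)..1, h x ^ 2) - (∫ x in (0:ℝ)..1, 2 * m * h x) + (∫ x in (0:ℝ)..1, m ^ 2) := by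
      rw [← intervalIntegral.integral_sub (I _ (by fun_prop)) (I _ (by fun_prop)),
        ← intervalIntegral.integral_add (I _ (by fun_prop)) (I _ (by fun_prop))]
      congr 1
      ext x
      simp only [hw]
      ring
    rw [this, intervalIntegral.integral_const_mul, ← hm]
    simp
    ring
  rw [e, ib] at hpos
  have hp : 0 < π ^ 2 := by positivity
  have : π ^ 2 * (∫ x in (0:ℝ)..1, w x ^ 2) ≤ ∫ x in (0:ℝ)..1, k x ^ 2 := by nlinarith
  rw [e2] at this
  have := (le_inv_mul_iff₀ hp).2 this
  linarith

/-- Schwarz in two variables. -/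
theorem schwarz2 (h hx hy H : ℝ → ℝ → ℝ)
    (h1 : ∀ x y, HasDerivAt (fun t => h t y) (hx x y) x)
    (h2 : ∀ x y, HasDerivAt (fun t => h x t) (hy x y) y)
    (h3 : ∀ x y, HasDerivAt (fun t => hx x t) (H x y) y)
    (chx : Continuous (Function.uncurry hx))
    (cH : Continuous (Function.uncurry H)) (x y : ℝ) :
    HasDerivAt (fun t => hy t y) (H x y) x := by
  have cH1 : ∀ y, Continuous fun t => H t y := fun y =>
    cH.comp (by fun_prop : Continuous fun t : ℝ => (t, y))
  have cH2 : ∀ x, Continuous fun t => H x t := fun x =>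
    cH.comp (by fun_prop : Continuous fun t : ℝ => (x, t))
  have chx1 : ∀ y, Continuous fun t => hx t y := fun y =>
    chx.comp (by fun_prop : Continuous fun t : ℝ => (t, y))
  have A : ∀ x y, hx x y = hx x 0 + ∫ s in (0:ℝ)..y, H x s := by
    intro x y
    rw [intervalIntegral.integral_eq_sub_of_hasDerivAt (f := fun t => hx x t) (fun s _ => h3 x s)
      ((cH2 x).intervalIntegrable _ _)]
    ring
  have cI : ∀ x, Continuous fun s => ∫ t in (0:ℝ)..x, H t s := by
    intro x
    apply intervalIntegral.continuous_parametric_intervalIntegral_of_continuous'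
      (f := fun s t => H t s)
    exact cH.comp continuous_swap
  have B : ∀ x y, h x y - h 0 y = h x 0 - h 0 0 + ∫ s in (0:ℝ)..y, ∫ t in (0:ℝ)..x, H t s := by
    intro x y
    rw [← intervalIntegral.integral_eq_sub_of_hasDerivAt (f := fun t => h t y) (fun s _ => h1 s y)
      ((chx1 y).intervalIntegrable _ _),
      ← intervalIntegral.integral_eq_sub_of_hasDerivAt (f := fun t => h t 0) (fun s _ => h1 s 0)
      ((chx1 0).intervalIntegrable _ _)]
    rw [MeasureTheory.intervalIntegral_intervalIntegral_swap]
    · rw [← intervalIntegral.integral_add ((chx1 0).intervalIntegrable _ _)]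
      · exact intervalIntegral.integral_congr fun t _ => A t y
      · apply Continuous.intervalIntegrable
        exact intervalIntegral.continuous_parametric_intervalIntegral_of_continuous' cH 0 y
    · apply IntegrableOn.mono_set _ (Set.prod_mono Set.uIoc_subset_uIcc Set.uIoc_subset_uIcc)
      apply ContinuousOn.integrableOn_compact (isCompact_uIcc.prod isCompact_uIcc)
      exact (cH.comp continuous_swap).continuousOn
  have C : ∀ x y, hy x y - hy 0 y = ∫ t in (0:ℝ)..x, H t y := by
    intro x y
    have d1 := (h2 x y).sub (h2 0 y)
    have d2 := (((cI x).integral_hasStrictDerivAt 0 y).hasDerivAt).const_add (h x 0 - h 0 0)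
    refine d1.unique (d2.congr_of_eventuallyEq (Filter.Eventually.of_forall fun y => ?_))
    exact B x y
  have d := (((cH1 y).integral_hasStrictDerivAt 0 x).hasDerivAt).const_add (hy 0 y)
  refine d.congr_of_eventuallyEq (Filter.Eventually.of_forall fun t => ?_)
  have := C t y
  simp only
  linarith

theorem upd_deriv {d : ℕ} {g k : (Fin d → ℝ) → ℝ} {j : Fin d}
    (h : ∀ x, HasDerivAt (fun t => g (Function.update x j t)) (k x) (x j)) (x : Fin d → ℝ) (t : ℝ) :
    HasDerivAt (fun s => g (Function.update x j s)) (k (Function.update x j t)) t := by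
  have := h (Function.update x j t)
  simpa using this

theorem schwarzd {d : ℕ} (g : (Fin d → ℝ) → ℝ) (a c : Fin d) (hac : a ≠ c)
    (h1 : ∀ x, DifferentiableAt ℝ (fun t => g (Function.update x a t)) (x a))
    (h2 : ∀ x, DifferentiableAt ℝ (fun t => g (Function.update x c t)) (x c))
    (h3 : ∀ x, DifferentiableAt ℝ (fun t => pderiv a g (Function.update x c t)) (x c))
    (ch : Continuous (pderiv a g)) (cH : Continuous (pderiv c (pderiv a g))) :
    pderiv a (pderiv c g) = pderiv c (pderiv a g) := by
  have k1 : ∀ x, HasDerivAt (fun t => g (Function.update x a t)) (pderiv a g x) (x a) :=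
    fun x => (h1 x).hasDerivAt
  have k2 : ∀ x, HasDerivAt (fun t => g (Function.update x c t)) (pderiv c g x) (x c) :=
    fun x => (h2 x).hasDerivAt
  have k3 : ∀ x, HasDerivAt (fun t => pderiv a g (Function.update x c t)) (pderiv c (pderiv a g) x) (x c) :=
    fun x => (h3 x).hasDerivAt
  funext x
  set P : ℝ → ℝ → (Fin d → ℝ) := fun s t => Function.update (Function.update x a s) c t with hP
  have P2 : ∀ s t, P s t = Function.update (Function.update x c t) a s := by
    intro s t
    exact Function.update_comm hac _ _ _
  have cP : Continuous (Function.uncurry P) := by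
    simp only [hP, Function.uncurry_def]
    fun_prop
  have S := schwarz2 (fun s t => g (P s t)) (fun s t => pderiv a g (P s t))
    (fun s t => pderiv c g (P s t)) (fun s t => pderiv c (pderiv a g) (P s t))
    (by
      intro s t
      simp only [P2]
      exact upd_deriv k1 _ _)
    (by
      intro s t
      exact upd_deriv k2 _ _)
    (by
      intro s t
      exact upd_deriv k3 _ _)
    (ch.comp cP) (cH.comp cP) (x a) (x c)
  have e : P (x a) (x c) = x := by simp [hP]
  rw [e] at S
  have S' : HasDerivAt (fun t => pderiv c g (Function.update x a t)) (pderiv c (pderiv a g) x) (x a) := by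
    refine S.congr_of_eventuallyEq (Filter.Eventually.of_forall fun t => ?_)
    simp [P2]
  exact S'.deriv

theorem foldr_perm {d : ℕ} {f : (Fin d → ℝ) → ℝ} (hf : SmoothEnough f) :
    ∀ (n : ℕ) (v : Finset (Fin d)) (l : List (Fin d)), v.card = n → l.Perm v.toList →
      l.foldr pderiv f = mderiv v f := by
  intro n
  induction n with
  | zero =>
    intro v l hv hl
    rw [Finset.card_eq_zero] at hv
    subst hv
    simp at hl
    subst hl
    simp [mderiv]
  | succ n ih =>
    intro v l hv hl
    -- any list enumerating v starts with a derivative of a smaller one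
    have main : ∀ l : List (Fin d), l.Perm v.toList → ∃ a ∈ v, l.foldr pderiv f = pderiv a (mderiv (v.erase a) f) := by
      intro l hl
      cases l with
      | nil =>
        have := hl.length_eq
        simp [hv] at this
      | cons a l =>
        have ha : a ∈ v := by
          rw [← Finset.mem_toList]
          exact hl.subset (by simp)
        refine ⟨a, ha, ?_⟩
        rw [List.foldr_cons, ih (v.erase a) l (by rw [Finset.card_erase_of_mem ha, hv]; rfl)]
        have h2 : v.toList.Perm (a :: (v.erase a).toList) := by
          conv_lhs => rw [← Finset.insert_erase ha]
          exact Finset.toList_insert (Finset.notMem_erase a v)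
        exact (List.perm_cons a).1 (hl.trans h2)
    obtain ⟨a, ha, e1⟩ := main l hl
    obtain ⟨c, hc, e2⟩ := main v.toList (List.Perm.refl _)
    change mderiv v f = _ at e2
    rw [e1, e2]
    by_cases hac : a = c
    · rw [hac]
    · have hstep : ∀ a c, a ∈ v → c ∈ v → a ≠ c →
          mderiv (v.erase c) f = pderiv a (mderiv ((v.erase c).erase a) f) := by
        intro a c ha hc hac
        symm
        have hm : a ∈ v.erase c := Finset.mem_erase.2 ⟨hac, ha⟩
        refine ih (v.erase c) (a :: ((v.erase c).erase a).toList) (by rw [Finset.card_erase_of_mem hc, hv]; rfl) ?_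
        conv_rhs => rw [← Finset.insert_erase hm]
        exact (Finset.toList_insert (Finset.notMem_erase a _)).symm
      have s1 := hstep a c ha hc hac
      have s2 := hstep c a hc ha (Ne.symm hac)
      rw [Finset.erase_right_comm] at s2
      rw [s1] at e2
      have c1 := hf.2 v
      have c2 := hf.2 (v.erase c)
      have d2 := hf.1 (v.erase c) c
      rw [e2] at c1
      rw [s1] at c2 d2
      rw [s1, s2]
      exact schwarzd _ a c hac (hf.1 _ a) (hf.1 _ c) d2 c2 c1

theorem mderiv_insert {d : ℕ} {f : (Fin d → ℝ) → ℝ} (hf : SmoothEnough f) (u : Finset (Fin d))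
    (j : Fin d) (hj : j ∉ u) : pderiv j (mderiv u f) = mderiv (insert j u) f :=
  foldr_perm hf _ (insert j u) (j :: u.toList) rfl (Finset.toList_insert hj).symm

theorem cube_measure (d : ℕ) : (volume : Measure (Fin d → ℝ)).restrict (cube d) =
    Measure.pi fun _ : Fin d => (volume : Measure ℝ).restrict (Set.Icc 0 1) := by
  rw [cube, volume_pi, Measure.restrict_pi_pi]

instance I01prob : IsProbabilityMeasure ((volume : Measure ℝ).restrict (Set.Icc 0 1)) :=
  ⟨by simp⟩

instance cubeprob (d : ℕ) : IsProbabilityMeasure ((volume : Measure (Fin d → ℝ)).restrict (cube d)) := by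
  rw [cube_measure]; infer_instance

theorem cube_compact (d : ℕ) : IsCompact (cube d) := isCompact_univ_pi fun _ => isCompact_Icc

theorem cube_integrable {d : ℕ} {h : (Fin d → ℝ) → ℝ} (hh : Continuous h) :
    Integrable h (volume.restrict (cube d)) :=
  hh.continuousOn.integrableOn_compact (cube_compact d)

theorem cube_map (d : ℕ) (j : Fin d) :
    (((volume : Measure (Fin d → ℝ)).restrict (cube d)).prod ((volume : Measure ℝ).restrict (Set.Icc 0 1))).map
      (fun p : (Fin d → ℝ) × ℝ => Function.update p.1 j p.2) = volume.restrict (cube d) := by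
  have hm : Measurable (fun p : (Fin d → ℝ) × ℝ => Function.update p.1 j p.2) :=
    (by fun_prop : Continuous (fun p : (Fin d → ℝ) × ℝ => Function.update p.1 j p.2)).measurable
  rw [cube_measure]
  symm
  apply Measure.pi_eq
  intro s hs
  rw [Measure.map_apply hm (MeasurableSet.univ_pi hs)]
  have : (fun p : (Fin d → ℝ) × ℝ => Function.update p.1 j p.2) ⁻¹' (Set.univ.pi s) =
      (Set.univ.pi (Function.update s j Set.univ)) ×ˢ (s j) := by
    ext ⟨z, t⟩
    simp only [Set.mem_preimage, Set.mem_univ_pi, Set.mem_prod]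
    constructor
    · intro h
      refine ⟨fun i => ?_, by simpa using h j⟩
      by_cases hi : i = j
      · subst hi; simp
      · simpa [hi] using h i
    · rintro ⟨h1, h2⟩ i
      by_cases hi : i = j
      · subst hi; simpa using h2
      · simpa [hi] using h1 i
  rw [this, Measure.prod_prod, Measure.pi_pi, ← Finset.mul_prod_erase _ _ (Finset.mem_univ j),
    ← Finset.mul_prod_erase (f := fun i => volume.restrict (Set.Icc (0:ℝ) 1) (s i)) _ (Finset.mem_univ j)]
  rw [Function.update_self, measure_univ, one_mul, mul_comm]
  congr 1
  apply Finset.prod_congr rfl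
  intro i hi
  rw [Function.update_of_ne (Finset.ne_of_mem_erase hi)]

theorem I01 (g : ℝ → ℝ) : ∫ t in (0:ℝ)..1, g t = ∫ t in Set.Icc (0:ℝ) 1, g t := by
  rw [intervalIntegral.integral_of_le zero_le_one, integral_Icc_eq_integral_Ioc]

theorem prod_integrable {d : ℕ} {h : (Fin d → ℝ) × ℝ → ℝ} (hh : Continuous h) :
    Integrable h (((volume : Measure (Fin d → ℝ)).restrict (cube d)).prod ((volume : Measure ℝ).restrict (Set.Icc 0 1))) := by
  rw [Measure.prod_restrict]
  exact hh.continuousOn.integrableOn_compact ((cube_compact d).prod isCompact_Icc)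

theorem cube_avg {d : ℕ} (j : Fin d) {h : (Fin d → ℝ) → ℝ} (hh : Continuous h) :
    ∫ z in cube d, h z = ∫ z in cube d, ∫ t in (0:ℝ)..1, h (Function.update z j t) := by
  have hm : Continuous (fun p : (Fin d → ℝ) × ℝ => Function.update p.1 j p.2) := by fun_prop
  conv_lhs => rw [← cube_map d j]
  rw [integral_map hm.measurable.aemeasurable hh.aestronglyMeasurable]
  simp only [I01]
  exact integral_prod _ (prod_integrable (hh.comp hm))

def sel {d : ℕ} (u : Finset (Fin d)) (x z : Fin d → ℝ) : Fin d → ℝ := fun j => if j ∈ u then x j else z j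

theorem sel_cont {d : ℕ} (u : Finset (Fin d)) : Continuous (Function.uncurry (sel u)) := by
  apply continuous_pi
  intro i
  simp only [Function.uncurry_def, sel]
  by_cases h : i ∈ u <;> simp only [h, if_true, if_false] <;> fun_prop

theorem marg_cont {d : ℕ} (u : Finset (Fin d)) {g : (Fin d → ℝ) → ℝ} (hg : Continuous g) :
    Continuous (margOut u g) :=
  continuous_parametric_integral_of_continuous (f := fun x z => g (sel u x z))
    (hg.comp (sel_cont u)) (cube_compact d)

theorem marg_erase {d : ℕ} (u : Finset (Fin d)) {g : (Fin d → ℝ) → ℝ} (hg : Continuous g)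
    (j : Fin d) (hj : j ∈ u) (x : Fin d → ℝ) :
    ∫ t in (0:ℝ)..1, margOut u g (Function.update x j t) = margOut (u.erase j) g x := by
  have e : ∀ z t, sel (u.erase j) x (Function.update z j t) = sel u (Function.update x j t) z := by
    intro z t
    funext i
    by_cases hi : i = j
    · subst hi; simp [sel, hj]
    · simp [sel, hi]
  have c2 : Continuous fun z => g (sel (u.erase j) x z) :=
    (hg.comp (sel_cont _)).comp (by fun_prop : Continuous fun z : Fin d → ℝ => (x, z))
  change _ = ∫ z in cube d, g (sel (u.erase j) x z)
  rw [cube_avg j c2]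
  simp only [e, I01]
  rw [integral_integral_swap]
  · rfl
  · apply prod_integrable
    have h1 : Continuous fun p : (Fin d → ℝ) × ℝ => (Function.update x j p.2, p.1) := by fun_prop
    exact (hg.comp (sel_cont u)).comp h1

theorem marg_deriv {d : ℕ} (u : Finset (Fin d)) {g k : (Fin d → ℝ) → ℝ} (hg : Continuous g)
    (hk : Continuous k) (j : Fin d) (hj : j ∈ u)
    (h : ∀ x, HasDerivAt (fun t => g (Function.update x j t)) (k x) (x j)) (x : Fin d → ℝ) :
    HasDerivAt (fun t => margOut u g (Function.update x j t)) (margOut u k x) (x j) := by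
  have e : ∀ z t, sel u (Function.update x j t) z = Function.update (sel u x z) j t := by
    intro z t
    funext i
    by_cases hi : i = j
    · subst hi; simp [sel, hj]
    · simp [sel, hi]
  have hm : Continuous (fun p : ℝ × (Fin d → ℝ) => sel u (Function.update x j p.1) p.2) := 
    (sel_cont u).comp (by fun_prop : Continuous fun p : ℝ × (Fin d → ℝ) => (Function.update x j p.1, p.2))
  have hz : ∀ t, Continuous (fun z : (Fin d → ℝ) => sel u (Function.update x j t) z) := fun t =>
    hm.comp (by fun_prop : Continuous fun z : Fin d → ℝ => (t, z))
  obtain ⟨C, hC⟩ := ((isCompact_Icc (a := x j - 1) (b := x j + 1)).prod (cube_compact d)).exists_bound_of_continuousOn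
    (hk.comp hm).continuousOn
  have := (hasDerivAt_integral_of_dominated_loc_of_deriv_le (μ := volume.restrict (cube d)) (x₀ := x j)
    (s := Set.Icc (x j - 1) (x j + 1)) (F := fun t z => g (sel u (Function.update x j t) z))
    (F' := fun t z => k (sel u (Function.update x j t) z)) (bound := fun _ => C)
    (Icc_mem_nhds (by linarith) (by linarith))
    (Filter.Eventually.of_forall fun t => (hg.comp (hz t)).aestronglyMeasurable)
    (cube_integrable (hg.comp (hz _))) ((hk.comp (hz _)).aestronglyMeasurable)
    (by
      refine (ae_restrict_iff' (cube_compact d).measurableSet).2 (Filter.Eventually.of_forall fun z hz t ht => ?_)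
      exact hC (t, z) ⟨ht, hz⟩)
    (integrable_const C)
    (Filter.Eventually.of_forall fun z t _ => by
      simp only [e]
      exact upd_deriv h _ _)).2
  simp only [Function.update_eq_self] at this
  exact this

theorem poincare_step {d : ℕ} (j : Fin d) (h k : (Fin d → ℝ) → ℝ) (hh : Continuous h) (hk : Continuous k)
    (hd : ∀ x, HasDerivAt (fun t => h (Function.update x j t)) (k x) (x j))
    (M : (Fin d → ℝ) → ℝ) (hM : Continuous M)
    (hM' : ∀ x, ∫ t in (0:ℝ)..1, h (Function.update x j t) = M x) :
    ∫ x in cube d, h x ^ 2 ≤ (∫ x in cube d, M x ^ 2) + (π ^ 2)⁻¹ * ∫ x in cube d, k x ^ 2 := by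
  rw [cube_avg j (h := fun x => h x ^ 2) (hh.pow 2), cube_avg j (h := fun x => k x ^ 2) (hk.pow 2)]
  have ci : ∀ g : (Fin d → ℝ) → ℝ, Continuous g → Continuous fun z => ∫ t in (0:ℝ)..1, g (Function.update z j t) := by
    intro g hg
    apply intervalIntegral.continuous_parametric_intervalIntegral_of_continuous'
      (f := fun z t => g (Function.update z j t))
    exact hg.comp (by fun_prop : Continuous fun p : (Fin d → ℝ) × ℝ => Function.update p.1 j p.2)
  have iM : Integrable (fun x => M x ^ 2) (volume.restrict (cube d)) := cube_integrable (hM.pow 2)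
  have ik : Integrable (fun z => (π ^ 2)⁻¹ * ∫ t in (0:ℝ)..1, k (Function.update z j t) ^ 2)
      (volume.restrict (cube d)) := (cube_integrable (ci (fun x => k x ^ 2) (hk.pow 2))).const_mul _
  rw [← integral_const_mul, ← integral_add iM ik]
  apply integral_mono (cube_integrable (ci (fun x => h x ^ 2) (hh.pow 2)))
  · exact iM.add ik
  · intro x
    simp only
    rw [← hM' x]
    exact poincare1 (fun t => h (Function.update x j t)) (fun t => k (Function.update x j t))
      (fun t => upd_deriv hd x t) (hk.comp (by fun_prop : Continuous fun t : ℝ => Function.update x j t))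

theorem main_ineq {d : ℕ} {f : (Fin d → ℝ) → ℝ} (hf : SmoothEnough f) (S : Finset (Fin d)) :
    ∫ x in cube d, f x ^ 2 ≤ ∑ u ∈ S.powerset, (π ^ (2 * u.card))⁻¹ *
      ∫ x in cube d, (margOut (u ∪ Sᶜ) (mderiv u f) x) ^ 2 := by
  induction S using Finset.induction_on with
  | empty => simp [mderiv, margOut]
  | insert j S hj ih =>
    refine ih.trans ?_
    rw [Finset.sum_powerset_insert hj, ← Finset.sum_add_distrib]
    apply Finset.sum_le_sum
    intro u hu
    have hju : j ∉ u := fun h => hj (Finset.mem_powerset.1 hu h)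
    have hjm : j ∈ u ∪ Sᶜ := by simp [hj]
    have e1 : u ∪ (insert j S)ᶜ = (u ∪ Sᶜ).erase j := by
      ext i; simp only [Finset.mem_union, Finset.mem_compl, Finset.mem_insert, Finset.mem_erase]
      by_cases hi : i = j
      · subst hi; simp [hju]
      · simp [hi]
    have e2 : insert j u ∪ (insert j S)ᶜ = u ∪ Sᶜ := by
      ext i; simp only [Finset.mem_union, Finset.mem_compl, Finset.mem_insert]
      by_cases hi : i = j
      · subst hi; simp [hj]
      · simp [hi]
    rw [e1, e2, Finset.card_insert_of_notMem hju]
    have := poincare_step j (margOut (u ∪ Sᶜ) (mderiv u f)) (margOut (u ∪ Sᶜ) (mderiv (insert j u) f))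
      (marg_cont _ (hf.2 _)) (marg_cont _ (hf.2 _))
      (marg_deriv _ (hf.2 _) (hf.2 _) j hjm (fun x => by
        rw [← mderiv_insert hf u j hju]
        exact (hf.1 u j x).hasDerivAt))
      (margOut ((u ∪ Sᶜ).erase j) (mderiv u f)) (marg_cont _ (hf.2 _))
      (marg_erase _ (hf.2 _) j hjm)
    have h2 := mul_le_mul_of_nonneg_left this (by positivity : 0 ≤ (π ^ (2 * u.card))⁻¹)
    refine h2.trans (le_of_eq ?_)
    rw [mul_add, ← mul_assoc, mul_add, mul_one, pow_add, mul_inv]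

theorem fvar_eq {d : ℕ} {f : (Fin d → ℝ) → ℝ} (hf : Continuous f) :
    fvar f = (∫ x in cube d, f x ^ 2) - fmean f ^ 2 := by
  have : fvar f = (∫ x in cube d, f x ^ 2) - (∫ x in cube d, 2 * fmean f * f x) + ∫ x in cube d, fmean f ^ 2 := by
    rw [← integral_sub (cube_integrable (by fun_prop)) (cube_integrable (by fun_prop)),
      ← integral_add (cube_integrable (by fun_prop)) (cube_integrable (by fun_prop))]
    rw [fvar]
    congr 1
    ext x
    ring
  rw [this, integral_const_mul]
  simp only [integral_const, probReal_univ, one_smul]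
  change _ - 2 * fmean f * fmean f + _ = _
  ring

theorem lower {d : ℕ} {hd : 0 < d} {γ : Finset (Fin d) → ℝ}
    (hγ : ∀ u, 0 < γ u)
    (hcond : ∀ u : Finset (Fin d), u ≠ ∅ →
      γ u / π ^ (2 * u.card) ≤ γ {⟨0, hd⟩} / π ^ 2)
    {f : (Fin d → ℝ) → ℝ} (hf : SmoothEnough f) :
    π ^ 2 / γ {⟨0, hd⟩} * fvar f ≤ wnorm2 γ f := by
  have cf : Continuous f := by simpa [mderiv] using hf.2 ∅
  have m := main_ineq hf Finset.univ
  simp only [Finset.compl_univ, Finset.union_empty, Finset.powerset_univ] at m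
  have e0 : (∫ x in cube d, (margOut ∅ (mderiv ∅ f) x) ^ 2) = fmean f ^ 2 := by
    simp [margOut, mderiv, fmean]
  rw [← Finset.add_sum_erase _ _ (Finset.mem_univ ∅), e0] at m
  rw [wnorm2, ← Finset.add_sum_erase _ _ (Finset.mem_univ ∅), e0, fvar_eq cf]
  have hp : 0 < π ^ 2 / γ {⟨0, hd⟩} := div_pos (by positivity) (hγ _)
  simp only [Finset.card_empty, mul_zero, pow_zero, inv_one, one_mul] at m
  have m2 := sub_le_iff_le_add'.2 m
  refine (mul_le_mul_of_nonneg_left m2 hp.le).trans ?_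
  have h0 : 0 ≤ (γ ∅)⁻¹ * fmean f ^ 2 := mul_nonneg (inv_nonneg.2 (hγ _).le) (sq_nonneg _)
  refine le_trans ?_ (le_add_of_nonneg_left h0)
  rw [Finset.mul_sum]
  apply Finset.sum_le_sum
  intro u hu
  rw [← mul_assoc]
  apply mul_le_mul_of_nonneg_right _ (integral_nonneg fun x => sq_nonneg _)
  have hc := hcond u (Finset.ne_of_mem_erase hu)
  have := hγ u
  have := hγ {⟨0, hd⟩}
  have := pi_pos
  rw [div_le_div_iff₀ (by positivity) (by positivity)] at hc
  rw [← div_eq_mul_inv, div_div, inv_eq_one_div, div_le_div_iff₀ (by positivity) (by positivity)]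
  linarith

/- attained -/

theorem ev_pderiv {d : ℕ} (i j : Fin d) (ψ : ℝ → ℝ) :
    pderiv j (fun x : Fin d → ℝ => ψ (x i)) = if j = i then (fun x => deriv ψ (x i)) else fun _ => 0 := by
  funext x
  by_cases h : j = i
  · subst h
    simp [pderiv]
  · simp [pderiv, h, Ne.symm h]

theorem ev_foldr {d : ℕ} (i : Fin d) (ψ : ℝ → ℝ) (hψ : ContDiff ℝ ⊤ ψ) (l : List (Fin d)) :
    ∃ φ : ℝ → ℝ, ContDiff ℝ ⊤ φ ∧ l.foldr pderiv (fun x : Fin d → ℝ => ψ (x i)) = fun x => φ (x i) := by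
  induction l with
  | nil => exact ⟨ψ, hψ, rfl⟩
  | cons j l ih =>
    obtain ⟨φ, h1, h2⟩ := ih
    rw [List.foldr_cons, h2, ev_pderiv]
    by_cases h : j = i
    · refine ⟨deriv φ, ?_, by simp [h]⟩
      exact (contDiff_succ_iff_deriv.1 (show ContDiff ℝ (⊤ + 1) φ from h1)).2.2
    · exact ⟨fun _ => 0, contDiff_const, by simp [h]⟩

theorem ev_zero {d : ℕ} (i : Fin d) (ψ : ℝ → ℝ) (hψ : ContDiff ℝ ⊤ ψ) (l : List (Fin d))
    (j : Fin d) (hj : j ∈ l) (hji : j ≠ i) :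
    l.foldr pderiv (fun x : Fin d → ℝ => ψ (x i)) = fun _ => 0 := by
  induction l with
  | nil => simp at hj
  | cons a l ih =>
    rw [List.foldr_cons]
    by_cases h : j ∈ l
    · rw [ih h]
      funext x
      simp [pderiv]
    · have : j = a := by simpa [h] using hj
      subst this
      obtain ⟨φ, _, h2⟩ := ev_foldr i ψ hψ l
      rw [h2, ev_pderiv]
      simp [hji]

theorem ev_smooth {d : ℕ} (i : Fin d) (ψ : ℝ → ℝ) (hψ : ContDiff ℝ ⊤ ψ) :
    SmoothEnough (fun x : Fin d → ℝ => ψ (x i)) := by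
  constructor
  · intro v j x
    obtain ⟨φ, h1, h2⟩ := ev_foldr i ψ hψ v.toList
    rw [mderiv, h2]
    have hφ : Differentiable ℝ φ := h1.differentiable (by simp)
    by_cases h : j = i
    · subst h; simpa using hφ _
    · simp [Ne.symm h]
  · intro v
    obtain ⟨φ, h1, h2⟩ := ev_foldr i ψ hψ v.toList
    rw [mderiv, h2]
    have := h1.continuous
    fun_prop

theorem ev_int {d : ℕ} (i : Fin d) (ψ : ℝ → ℝ) (hψ : Continuous ψ) :
    ∫ x in cube d, ψ (x i) = ∫ t in (0:ℝ)..1, ψ t := by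
  rw [cube_avg i (h := fun x => ψ (x i)) (by fun_prop)]
  simp

theorem int_psi : ∫ t in (0:ℝ)..1, √2 * sin (π * (t - 1/2)) = 0 := by
  have hp := pi_ne_zero
  rw [intervalIntegral.integral_eq_sub_of_hasDerivAt (f := fun t => - (√2 / π) * cos (π * (t - 1/2)))]
  · have : π * (0 - 1/2) = - (π * (1 - 1/2)) := by ring
    rw [this, cos_neg]; ring
  · intro x _
    have h1 : HasDerivAt (fun t : ℝ => π * (t - 1/2)) (π * 1) x := ((hasDerivAt_id x).sub_const (1/2)).const_mul π
    convert! h1.cos.const_mul (- (√2 / π)) using 1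
    field_simp
  · exact (by fun_prop : Continuous fun t => √2 * sin (π * (t - 1/2))).intervalIntegrable _ _

theorem int_psi2 : ∫ t in (0:ℝ)..1, (√2 * sin (π * (t - 1/2))) ^ 2 = 1 := by
  have hp := pi_ne_zero
  rw [intervalIntegral.integral_eq_sub_of_hasDerivAt (f := fun t => t - (1 / π) * (sin (π * (t - 1/2)) * cos (π * (t - 1/2))))]
  · have e1 : π * (0 - 1/2) = - (π / 2) := by ring
    have e2 : π * (1 - 1/2) = π / 2 := by ring
    rw [e1, e2, cos_neg]; simp
  · intro x _
    have h1 : HasDerivAt (fun t : ℝ => π * (t - 1/2)) (π * 1) x := ((hasDerivAt_id x).sub_const (1/2)).const_mul π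
    convert! (hasDerivAt_id x).sub ((h1.sin.mul h1.cos).const_mul (1 / π)) using 1
    rw [mul_pow, sq_sqrt (by norm_num)]
    have := sin_sq_add_cos_sq (π * (x - 1/2))
    simp only [mul_one]
    set S := sin (π * (x - 1/2))
    set C := cos (π * (x - 1/2))
    field_simp
    linarith
  · exact (by fun_prop : Continuous fun t => (√2 * sin (π * (t - 1/2))) ^ 2).intervalIntegrable _ _

theorem int_psi3 : ∫ t in (0:ℝ)..1, (√2 * (cos (π * (t - 1/2)) * π)) ^ 2 = π ^ 2 := by
  have e : ∀ t : ℝ, (√2 * (cos (π * (t - 1/2)) * π)) ^ 2 = 2 * π ^ 2 - π ^ 2 * (√2 * sin (π * (t - 1/2))) ^ 2 := by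
    intro t
    have := sin_sq_add_cos_sq (π * (t - 1/2))
    rw [mul_pow, mul_pow √2, sq_sqrt (by norm_num), mul_pow]
    linear_combination 2 * π ^ 2 * this
  simp only [e]
  rw [intervalIntegral.integral_sub, intervalIntegral.integral_const_mul (π ^ 2), int_psi2]
  · simp; ring
  · simp
  · exact (by fun_prop : Continuous fun t => π ^ 2 * (√2 * sin (π * (t - 1/2))) ^ 2).intervalIntegrable _ _


/-- Proposition 1: if `γ_{{1}} π⁻² ≥ γ_u π^{-2|u|}` for all nonempty `u`, then the
smallest `ρ > 0` such that the ball `B(γ,ρ)` contains a function of unit variance is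
`ρ* = π / √γ_{{1}}`. -/
theorem critical_radius (d : ℕ) (hd : 0 < d) (γ : Finset (Fin d) → ℝ)
    (hγ : ∀ u, 0 < γ u)
    (hcond : ∀ u : Finset (Fin d), u ≠ ∅ →
      γ u / π ^ (2 * u.card) ≤ γ {⟨0, hd⟩} / π ^ 2) :
    IsLeast {ρ : ℝ | 0 < ρ ∧ ∃ f : (Fin d → ℝ) → ℝ,
        SmoothEnough f ∧ wnorm2 γ f ≤ ρ ^ 2 ∧ fvar f = 1}
      (π / Real.sqrt (γ {⟨0, hd⟩})) := by
  have hg := hγ {⟨0, hd⟩}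
  have hs : 0 < √(γ {⟨0, hd⟩}) := sqrt_pos.2 hg
  have hsq : (π / √(γ {⟨0, hd⟩})) ^ 2 = π ^ 2 / γ {⟨0, hd⟩} := by
    rw [div_pow, sq_sqrt hg.le]
  constructor
  · refine ⟨div_pos pi_pos hs, ?_⟩
    set i : Fin d := ⟨0, hd⟩ with hi
    set ψ : ℝ → ℝ := fun t => √2 * sin (π * (t - 1/2)) with hψd
    have hψ : ContDiff ℝ ⊤ ψ := by
      simp only [hψd]
      fun_prop
    have hdψ : deriv ψ = fun t => √2 * (cos (π * (t - 1/2)) * π) := by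
      funext x
      have h1 : HasDerivAt (fun t : ℝ => π * (t - 1/2)) (π * 1) x :=
        ((hasDerivAt_id x).sub_const (1/2)).const_mul π
      rw [mul_one] at h1
      exact (h1.sin.const_mul √2).deriv
    have hmean : ∫ x in cube d, ψ (x i) = 0 := by
      rw [ev_int i ψ hψ.continuous]
      exact int_psi
    refine ⟨fun x => ψ (x i), ev_smooth i ψ hψ, ?_, ?_⟩
    · rw [hsq, wnorm2, Finset.sum_eq_single {i}]
      · have e : mderiv {i} (fun x : Fin d → ℝ => ψ (x i)) = fun x => deriv ψ (x i) := by
          rw [mderiv, Finset.toList_singleton]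
          rw [List.foldr_cons, List.foldr_nil]
          rw [ev_pderiv]
          simp
        have e2 : ∀ x, margOut {i} (mderiv {i} (fun x : Fin d → ℝ => ψ (x i))) x = deriv ψ (x i) := by
          intro x
          rw [e]
          simp [margOut]
        simp only [e2, hdψ]
        rw [ev_int i (fun t => (√2 * (cos (π * (t - 1/2)) * π)) ^ 2) (by fun_prop), int_psi3]
        apply le_of_eq
        ring
      · intro u _ hu
        by_cases h : ∃ j ∈ u, j ≠ i
        · obtain ⟨j, hj, hji⟩ := h
          rw [mderiv, ev_zero i ψ hψ u.toList j (by simpa using hj) hji]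
          simp [margOut]
        · push Not at h
          have : u = ∅ := by
            rcases Finset.subset_singleton_iff.1 (fun j hj => Finset.mem_singleton.2 (h j hj) : u ⊆ {i}) with h | h
            · exact h
            · exact absurd h hu
          subst this
          have : ∀ x, margOut ∅ (mderiv ∅ (fun x : Fin d → ℝ => ψ (x i))) x = 0 := by
            intro x
            simpa [margOut, mderiv] using hmean
          simp [this]
      · simp
    · have hm : fmean (fun x : Fin d → ℝ => ψ (x i)) = 0 := hmean
      rw [fvar, hm]
      simp only [sub_zero]
      rw [ev_int i (fun t => ψ t ^ 2) (hψ.continuous.pow 2)]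
      exact int_psi2
  · rintro ρ ⟨hρ, f, hf, hn, hv⟩
    have := lower hγ hcond hf
    rw [hv, mul_one, ← hsq] at this
    exact (pow_le_pow_iff_left₀ (div_pos pi_pos hs).le hρ.le two_ne_zero).1 (this.trans hn)
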